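/- Let p be a prime, d ≥ 1, g : Z_p^d → ℝ with ‖g‖₂ = 1, E = supp(g), and suppose g(x) > 0 for all x ∈ E. Let A, B ⊆ Z_p^d. Then G(g, A, B) is an orthonormal basis of L²(Z_p^d) if and only if: (i) g = |E|^{-1/2}·1_E; (ii) (E, B) is a spectral pair; (iii) (E, A) is a tiling pair. -/

import Mathlib

open Finset

/-- The fixed character `χ(t) = e^{2πi t/p}` of `ℤ/p`. -/
noncomputable def chi (p : ℕ) (t : ZMod p) : ℂ :=
  Complex.exp (2 * Real.pi * Complex.I * (t.val : ℂ) / (p : ℂ))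

/-- The dot product on `ℤ_p^d`. -/
def dotp {p d : ℕ} (x y : Fin d → ZMod p) : ZMod p := ∑ i, x i * y i

/-- The Gabor (time-frequency shifted) function `x ↦ g(x-a) χ(x·b)`. -/
noncomputable def gabor {p d : ℕ} (g : (Fin d → ZMod p) → ℂ) (a b : Fin d → ZMod p) :
    (Fin d → ZMod p) → ℂ :=
  fun x => g (x - a) * chi p (dotp x b)

/-- The inner product of `L²` with counting measure on a finite type. -/
noncomputable def innerC {V : Type*} [Fintype V] (f g : V → ℂ) : ℂ :=
  ∑ x, f x * (starRingEnd ℂ) (g x)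

/-- `𝒢(g, A, B)` is an orthonormal basis of `L²(ℤ_p^d)`: the family is orthonormal and
every function is a linear combination of its members. -/
def IsGaborONB {p d : ℕ} [NeZero p] (g : (Fin d → ZMod p) → ℂ)
    (A B : Finset (Fin d → ZMod p)) : Prop :=
  (∀ a ∈ A, ∀ b ∈ B, ∀ a' ∈ A, ∀ b' ∈ B,
    innerC (gabor g a b) (gabor g a' b') = if a = a' ∧ b = b' then 1 else 0)
  ∧ (∀ f : (Fin d → ZMod p) → ℂ, ∃ c : (Fin d → ZMod p) → (Fin d → ZMod p) → ℂ,
      f = fun x => ∑ a ∈ A, ∑ b ∈ B, c a b * gabor g a b x)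

/-- `(E, B)` is a spectral pair: the characters indexed by `B` are pairwise orthogonal in
`L²(E)` and span it. -/
def IsSpectralPair {p d : ℕ} [NeZero p] (E B : Finset (Fin d → ZMod p)) : Prop :=
  (∀ b ∈ B, ∀ b' ∈ B, b ≠ b' → ∑ x ∈ E, chi p (dotp x (b - b')) = 0)
  ∧ (∀ f : (Fin d → ZMod p) → ℂ, ∃ c : (Fin d → ZMod p) → ℂ,
      ∀ x ∈ E, f x = ∑ b ∈ B, c b * chi p (dotp x b))

/-- `(E, A)` is a tiling pair: `Σ_{a∈A} 1_E(x-a) = 1` for every `x`. -/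
def IsTilingPair {p d : ℕ} [NeZero p] (E A : Finset (Fin d → ZMod p)) : Prop :=
  ∀ x : Fin d → ZMod p, (∑ a ∈ A, if x - a ∈ E then (1 : ℕ) else 0) = 1

/-- The Fourier transform `ĝ(m) = p^{-d} Σ_x χ(-x·m) g(x)` on `ℤ_p^d`. -/
noncomputable def ft {p d : ℕ} [NeZero p] (g : (Fin d → ZMod p) → ℂ)
    (m : Fin d → ZMod p) : ℂ :=
  ((p : ℂ) ^ d)⁻¹ * ∑ x, chi p (-(dotp x m)) * g x

section Characters

variable {p d : ℕ}

lemma dotp_sub_right (x b c : Fin d → ZMod p) : dotp x (b - c) = dotp x b - dotp x c := by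
  simp [dotp, mul_sub, Finset.sum_sub_distrib]

lemma dotp_zero_right (x : Fin d → ZMod p) : dotp x 0 = 0 := by
  simp [dotp]

lemma dotp_add_left (x y b : Fin d → ZMod p) : dotp (x + y) b = dotp x b + dotp y b := by
  simp [dotp, add_mul, Finset.sum_add_distrib]

variable [NeZero p]

lemma chi_eq_stdAddChar (t : ZMod p) : chi p t = ZMod.stdAddChar t := by
  rw [ZMod.stdAddChar_apply, ZMod.toCircle_apply, chi]

lemma chi_add (s t : ZMod p) : chi p (s + t) = chi p s * chi p t := by
  simp only [chi_eq_stdAddChar, AddChar.map_add_eq_mul]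

lemma chi_zero : chi p 0 = 1 := by
  simp only [chi_eq_stdAddChar, AddChar.map_zero_eq_one]

lemma chi_mul_chi_neg (t : ZMod p) : chi p t * chi p (-t) = 1 := by
  rw [← chi_add, add_neg_cancel, chi_zero]

lemma chi_ne_zero (t : ZMod p) : chi p t ≠ 0 :=
  left_ne_zero_of_mul_eq_one (chi_mul_chi_neg t)

lemma conj_chi (t : ZMod p) : (starRingEnd ℂ) (chi p t) = chi p (-t) := by
  simp only [chi_eq_stdAddChar, AddChar.map_neg_eq_conj]

lemma chi_sub (s t : ZMod p) : chi p (s - t) = chi p s * chi p (-t) := by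
  rw [sub_eq_add_neg, chi_add]

end Characters

section Gabor

variable {p d : ℕ} [NeZero p] {g : (Fin d → ZMod p) → ℝ} {E A B : Finset (Fin d → ZMod p)}

lemma innerC_gabor (g : (Fin d → ZMod p) → ℝ) (a b a' b' : Fin d → ZMod p) :
    innerC (gabor (fun x => (g x : ℂ)) a b) (gabor (fun x => (g x : ℂ)) a' b') =
      ∑ x, (g (x - a) : ℂ) * g (x - a') * chi p (dotp x (b - b')) := by
  refine Finset.sum_congr rfl fun x _ => ?_
  simp only [gabor, map_mul, conj_chi, Complex.conj_ofReal, dotp_sub_right, chi_sub]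
  ring

lemma innerC_gabor_same_shift (g : (Fin d → ZMod p) → ℝ) (a b b' : Fin d → ZMod p) :
    innerC (gabor (fun x => (g x : ℂ)) a b) (gabor (fun x => (g x : ℂ)) a b') =
      chi p (dotp a (b - b')) * ∑ x, (g x : ℂ) ^ 2 * chi p (dotp x (b - b')) := by
  rw [innerC_gabor, Finset.mul_sum, ← Equiv.sum_comp (Equiv.addRight a)]
  refine Finset.sum_congr rfl fun x _ => ?_
  simp only [Equiv.coe_addRight, add_sub_cancel_right, dotp_add_left, chi_add]
  ring

lemma IsTilingPair.exists_mem (h : IsTilingPair E A) (x : Fin d → ZMod p) :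
    ∃ a ∈ A, x - a ∈ E := by
  by_contra! hx
  have h1 := h x
  rw [Finset.sum_eq_zero fun a ha => if_neg (hx a ha)] at h1
  exact zero_ne_one h1

lemma IsTilingPair.eq_of_mem (h : IsTilingPair E A) {x a a' : Fin d → ZMod p}
    (ha : a ∈ A) (ha' : a' ∈ A) (hx : x - a ∈ E) (hx' : x - a' ∈ E) : a = a' := by
  have h1 := h x
  rw [← Finset.card_filter, Finset.card_eq_one] at h1
  obtain ⟨c, hc⟩ := h1
  have h2 : a ∈ ({c} : Finset _) := hc ▸ Finset.mem_filter.2 ⟨ha, hx⟩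
  have h3 : a' ∈ ({c} : Finset _) := hc ▸ Finset.mem_filter.2 ⟨ha', hx'⟩
  rw [Finset.mem_singleton.1 h2, Finset.mem_singleton.1 h3]

lemma isTilingPair_of_existsUnique
    (h : ∀ x : Fin d → ZMod p, ∃ a ∈ A, x - a ∈ E ∧ ∀ a' ∈ A, x - a' ∈ E → a' = a) :
    IsTilingPair E A := by
  intro x
  obtain ⟨a, ha, hx, hu⟩ := h x
  rw [Finset.sum_eq_single_of_mem a ha fun a' ha' hne => if_neg fun hx' => hne (hu a' ha' hx'),
    if_pos hx]

/-- If the Gabor system of a nonnegative window is an orthonormal basis, then the translates of the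
support of the window tile. -/
lemma IsGaborONB.isTilingPair (h : IsGaborONB (fun x => (g x : ℂ)) A B)
    (hE : ∀ x, x ∈ E ↔ g x ≠ 0) (hnonneg : ∀ x, 0 ≤ g x) : IsTilingPair E A := by
  refine isTilingPair_of_existsUnique fun x => ?_
  obtain ⟨c, hc⟩ := h.2 fun _ => 1
  have hx : ∑ a ∈ A, ∑ b ∈ B, c a b * gabor (fun x => (g x : ℂ)) a b x ≠ 0 := by
    rw [← congrFun hc x]; exact one_ne_zero
  obtain ⟨a, ha, hxa⟩ := Finset.exists_ne_zero_of_sum_ne_zero hx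
  obtain ⟨b, hb, hxb⟩ := Finset.exists_ne_zero_of_sum_ne_zero hxa
  have hgx : g (x - a) ≠ 0 := fun h0 => hxb (by simp [gabor, h0])
  refine ⟨a, ha, (hE _).2 hgx, fun a' ha' hx' => ?_⟩
  by_contra hne
  have horth := h.1 a' ha' b hb a ha b hb
  rw [if_neg fun hh => hne hh.1, innerC_gabor] at horth
  have hsum : ∑ y, g (y - a') * g (y - a) = 0 := by
    simp only [sub_self, dotp_zero_right, chi_zero, mul_one] at horth
    exact_mod_cast horth
  rw [Finset.sum_eq_zero_iff_of_nonneg fun y _ => mul_nonneg (hnonneg _) (hnonneg _)] at hsum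
  exact mul_ne_zero ((hE _).1 hx') hgx (hsum x (Finset.mem_univ x))

/-- If the Gabor system is an orthonormal basis and the translates of the support of the window
tile, then the characters span the functions on the support. -/
lemma IsGaborONB.exists_character_expansion (h : IsGaborONB (fun x => (g x : ℂ)) A B)
    (hE : ∀ x, x ∈ E ↔ g x ≠ 0) (hA : IsTilingPair E A) (f : (Fin d → ZMod p) → ℂ) :
    ∃ c : (Fin d → ZMod p) → ℂ, ∀ x ∈ E, f x = ∑ b ∈ B, c b * chi p (dotp x b) := by
  obtain ⟨a, ha, -⟩ := hA.exists_mem 0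
  obtain ⟨c, hc⟩ := h.2 fun y => f (y - a) * g (y - a)
  refine ⟨fun b => c a b * chi p (dotp a b), fun x hx => ?_⟩
  have hgx : (g x : ℂ) ≠ 0 := Complex.ofReal_ne_zero.2 ((hE x).1 hx)
  have hxa := congrFun hc (x + a)
  rw [Finset.sum_eq_single_of_mem a ha] at hxa
  · simp only [gabor, add_sub_cancel_right] at hxa
    apply mul_right_cancel₀ hgx
    rw [hxa, Finset.sum_mul]
    refine Finset.sum_congr rfl fun b _ => ?_
    rw [dotp_add_left, chi_add]
    ring
  · intro a' ha' hne
    have h0 : g (x + a - a') = 0 := by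
      by_contra h0
      exact hne (hA.eq_of_mem ha' ha ((hE _).2 h0) (by simpa using hx))
    exact Finset.sum_eq_zero fun b _ => by simp [gabor, h0]

/-- The characters are orthonormal for the weight `g ^ 2`. -/
lemma IsGaborONB.sum_sq_mul_chi (h : IsGaborONB (fun x => (g x : ℂ)) A B)
    (hA : A.Nonempty) {b b' : Fin d → ZMod p} (hb : b ∈ B) (hb' : b' ∈ B) :
    ∑ x, (g x : ℂ) ^ 2 * chi p (dotp x (b - b')) = if b = b' then 1 else 0 := by
  obtain ⟨a, ha⟩ := hA
  have h1 := h.1 a ha b hb a ha b' hb'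
  rw [innerC_gabor_same_shift] at h1
  by_cases hbb : b = b'
  · subst hbb
    simpa [dotp_zero_right, chi_zero] using h1
  · simpa [hbb, chi_ne_zero] using h1

/-- If the characters indexed by `B` are orthonormal for the weight `g ^ 2` and span the functions
on the support `E` of `g`, then `g ^ 2` is constant on `E`, equal to `1 / |B|`. -/
lemma card_mul_sq_eq_one (hE : ∀ x, x ∈ E ↔ g x ≠ 0)
    (horth : ∀ b ∈ B, ∀ b' ∈ B,
      ∑ x, (g x : ℂ) ^ 2 * chi p (dotp x (b - b')) = if b = b' then 1 else 0)
    (hspan : ∀ f : (Fin d → ZMod p) → ℂ, ∃ c : (Fin d → ZMod p) → ℂ,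
      ∀ x ∈ E, f x = ∑ b ∈ B, c b * chi p (dotp x b))
    {y : Fin d → ZMod p} (hy : y ∈ E) : (B.card : ℝ) * g y ^ 2 = 1 := by
  obtain ⟨c, hc⟩ := hspan fun x => if x = y then 1 else 0
  have hcoef : ∀ b' ∈ B, c b' = (g y : ℂ) ^ 2 * chi p (-dotp y b') := by
    intro b' hb'
    have hleft : ∑ x, (g x : ℂ) ^ 2 * chi p (-dotp x b') * (if x = y then 1 else 0) =
        (g y : ℂ) ^ 2 * chi p (-dotp y b') := by simp
    rw [← hleft]
    have hpt : ∀ x, (g x : ℂ) ^ 2 * chi p (-dotp x b') * (if x = y then 1 else 0) =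
        ∑ b ∈ B, c b * ((g x : ℂ) ^ 2 * chi p (dotp x (b - b'))) := by
      intro x
      by_cases hx : x ∈ E
      · rw [hc x hx, Finset.mul_sum]
        refine Finset.sum_congr rfl fun b _ => ?_
        rw [dotp_sub_right, chi_sub]
        ring
      · have h0 : g x = 0 := by simpa [hE] using hx
        simp [h0]
    simp only [hpt]
    rw [Finset.sum_comm]
    simp only [← Finset.mul_sum]
    rw [Finset.sum_eq_single_of_mem b' hb' fun b hb hne => by
      rw [horth b hb b' hb', if_neg hne, mul_zero], horth b' hb' b' hb', if_pos rfl, mul_one]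
  have hy1 := hc y hy
  rw [if_pos rfl, Finset.sum_congr rfl fun b hb => by
    rw [hcoef b hb, mul_assoc, mul_comm (chi p _), chi_mul_chi_neg, mul_one],
    Finset.sum_const, nsmul_eq_mul] at hy1
  exact_mod_cast hy1.symm

lemma sum_sq_mul_chi_of_const (hgE : ∀ x, g x = if x ∈ E then (Real.sqrt E.card)⁻¹ else 0)
    (m : Fin d → ZMod p) :
    ∑ x, (g x : ℂ) ^ 2 * chi p (dotp x m) = (E.card : ℂ)⁻¹ * ∑ x ∈ E, chi p (dotp x m) := by
  have hsq : ∀ x, (g x : ℂ) ^ 2 = if x ∈ E then (E.card : ℂ)⁻¹ else 0 := by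
    intro x
    have : g x ^ 2 = if x ∈ E then (E.card : ℝ)⁻¹ else 0 := by
      rw [hgE x]
      split_ifs
      · rw [inv_pow, Real.sq_sqrt (Nat.cast_nonneg _)]
      · simp
    rw [← Complex.ofReal_pow, this]
    split_ifs <;> simp
  simp only [hsq, ite_mul, zero_mul, Finset.sum_ite_mem, Finset.univ_inter, Finset.mul_sum]

lemma isGaborONB_of_const (hEne : E.Nonempty)
    (hgE : ∀ x, g x = if x ∈ E then (Real.sqrt E.card)⁻¹ else 0)
    (hB : IsSpectralPair E B) (hA : IsTilingPair E A) :
    IsGaborONB (fun x => (g x : ℂ)) A B := by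
  have hcard : (E.card : ℂ) ≠ 0 := Nat.cast_ne_zero.2 hEne.card_pos.ne'
  refine ⟨fun a ha b hb a' ha' b' hb' => ?_, fun f => ?_⟩
  · by_cases haa : a = a'
    · subst haa
      rw [innerC_gabor_same_shift, sum_sq_mul_chi_of_const hgE]
      by_cases hbb : b = b'
      · subst hbb
        simp [dotp_zero_right, chi_zero, hcard]
      · rw [hB.1 b hb b' hb' hbb]
        simp [hbb]
    · rw [innerC_gabor, if_neg fun h => haa h.1]
      refine Finset.sum_eq_zero fun x _ => ?_
      by_cases hx : x - a ∈ E
      · have hx' : x - a' ∉ E := fun hx' => haa (hA.eq_of_mem ha ha' hx hx')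
        simp [hgE (x - a'), hx']
      · simp [hgE (x - a), hx]
  · have hs : (Real.sqrt E.card : ℂ) ≠ 0 := by
      rw [Complex.ofReal_ne_zero, Real.sqrt_ne_zero (Nat.cast_nonneg _)]
      exact_mod_cast hcard
    choose c hc using fun a => hB.2 fun x => f (x + a) * Real.sqrt E.card
    refine ⟨fun a b => c a b * chi p (-dotp a b), funext fun x => ?_⟩
    obtain ⟨a, ha, hx⟩ := hA.exists_mem x
    rw [Finset.sum_eq_single_of_mem a ha]
    · have hxa := hc a _ hx
      rw [sub_add_cancel] at hxa
      apply mul_right_cancel₀ hs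
      rw [hxa, Finset.sum_mul]
      refine Finset.sum_congr rfl fun b _ => ?_
      have hdot : dotp x b = dotp (x - a) b + dotp a b := by
        rw [← dotp_add_left, sub_add_cancel]
      rw [gabor, hgE, if_pos hx, hdot, chi_add, Complex.ofReal_inv]
      field_simp
      linear_combination (-(c a b * chi p (dotp (x - a) b))) * chi_mul_chi_neg (dotp a b)
    · intro a' ha' hne
      have hx' : x - a' ∉ E := fun hx' => hne (hA.eq_of_mem ha' ha hx' hx)
      exact Finset.sum_eq_zero fun b _ => by simp [gabor, hgE (x - a'), hx']

end Gabor

/-- If `g : ℤ_p^d → ℝ` has `‖g‖₂ = 1`, support `E`, and is positive on `E`,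
then `𝒢(g,A,B)` is an orthonormal basis of `L²(ℤ_p^d)` iff `g = |E|^{-1/2} 1_E`,
`(E,B)` is a spectral pair and `(E,A)` is a tiling pair. -/
theorem gabor_onb_iff_of_positive_window
    (p : ℕ) [Fact p.Prime] (d : ℕ) (hd : 1 ≤ d)
    (g : (Fin d → ZMod p) → ℝ) (hg : ∑ x, g x ^ 2 = 1)
    (E : Finset (Fin d → ZMod p)) (hE : E = Finset.univ.filter (fun x => g x ≠ 0))
    (hpos : ∀ x ∈ E, 0 < g x)
    (A B : Finset (Fin d → ZMod p)) :
    IsGaborONB (fun x => (g x : ℂ)) A B ↔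
      ((∀ x, g x = if x ∈ E then (Real.sqrt E.card)⁻¹ else 0)
        ∧ IsSpectralPair E B ∧ IsTilingPair E A) := by
  have hmem : ∀ x, x ∈ E ↔ g x ≠ 0 := fun x => by simp [hE]
  have hEne : E.Nonempty := by
    obtain ⟨x, -, hx⟩ := Finset.exists_ne_zero_of_sum_ne_zero (hg ▸ one_ne_zero)
    exact ⟨x, (hmem x).2 fun h0 => hx (by simp [h0])⟩
  refine ⟨fun h => ?_, fun h => isGaborONB_of_const hEne h.1 h.2.1 h.2.2⟩
  have hnonneg : ∀ x, 0 ≤ g x := fun x => by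
    by_cases hx : x ∈ E
    · exact (hpos x hx).le
    · exact (not_not.1 ((hmem x).not.1 hx)).ge
  have hA := h.isTilingPair hmem hnonneg
  have hspan := h.exists_character_expansion hmem hA
  obtain ⟨a, ha, -⟩ := hA.exists_mem 0
  have horth := fun b (hb : b ∈ B) b' (hb' : b' ∈ B) => h.sum_sq_mul_chi ⟨a, ha⟩ hb hb'
  have hsq := fun y (hy : y ∈ E) => card_mul_sq_eq_one hmem horth hspan hy
  have hBE : (B.card : ℝ) = E.card := by
    have hsum : ∑ x ∈ E, g x ^ 2 = 1 := by
      rw [← hg]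
      refine Finset.sum_subset (Finset.subset_univ E) fun x _ hx => ?_
      simp [not_not.1 ((hmem x).not.1 hx)]
    have := Finset.sum_congr rfl hsq
    rw [← Finset.mul_sum, hsum] at this
    simpa using this
  have hgE : ∀ x, g x = if x ∈ E then (Real.sqrt E.card)⁻¹ else 0 := by
    intro x
    split_ifs with hx
    · rw [← Real.sqrt_inv, eq_comm, Real.sqrt_eq_iff_eq_sq (by positivity) (hnonneg x), ← hBE]
      exact inv_eq_of_mul_eq_one_right (hsq x hx)
    · exact not_not.1 ((hmem x).not.1 hx)
  refine ⟨hgE, ⟨fun b hb b' hb' hne => ?_, hspan⟩, hA⟩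
  have h0 := horth b hb b' hb'
  rw [sum_sq_mul_chi_of_const hgE, if_neg hne] at h0
  have hcard : (E.card : ℂ) ≠ 0 := Nat.cast_ne_zero.2 hEne.card_pos.ne'
  exact (mul_eq_zero.1 h0).resolve_left (inv_ne_zero hcard)
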